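/- Let m and k be integers with m ≥ 5, 1 ≤ k and 2k ≤ m, and let b(m,k) denote the minimal base size of the symmetric group Sym(m) acting on the set Ω(m,k) of all k-element subsets of {1,…,m}. Then b(m,k) ≤ 2·ln(m!) / ln C(m,k) + 16. -/

import Mathlib

open Pointwise

lemma sum_insert_erase_add {α : Type*} [DecidableEq α] (F : Finset α) {a b : α} (ha : a ∈ F)
    (hb : b ∉ F) (g : α → ℕ) :
    ∑ x ∈ insert b (F.erase a), g x + g a = ∑ x ∈ F, g x + g b := by
  rw [Finset.sum_insert (fun h => hb (Finset.mem_of_mem_erase h)),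
    ← Finset.add_sum_erase F g ha]
  ring

/-- The number of members of `F` containing `i`. -/
def memDegree {n : ℕ} (F : Finset (Finset (Fin n))) (i : Fin n) : ℕ :=
  ∑ A ∈ F, if i ∈ A then 1 else 0

lemma memDegree_eq_card {n : ℕ} (F : Finset (Finset (Fin n))) (i : Fin n) :
    memDegree F i = (F.filter (fun A => i ∈ A)).card := by
  simp [memDegree]

lemma sum_memDegree {n : ℕ} (F : Finset (Finset (Fin n))) :
    ∑ i, memDegree F i = ∑ A ∈ F, A.card := by
  unfold memDegree
  rw [Finset.sum_comm]
  simp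

/-- An element that lies in fewer than half of the members of `F` can be added to one of them. -/
lemma exists_insert_notMem {n : ℕ} (F : Finset (Finset (Fin n))) (j : Fin n)
    (h : 2 * memDegree F j < F.card) : ∃ A ∈ F, j ∉ A ∧ insert j A ∉ F := by
  by_contra! hc
  have h1 : (F.filter (fun A => ¬ j ∈ A)).card ≤ (F.filter (fun A => j ∈ A)).card := by
    apply Finset.card_le_card_of_injOn (fun A => insert j A)
    · intro A hA
      simp only [Finset.coe_filter, Set.mem_ofPred_eq] at hA ⊢
      exact ⟨hc A hA.1 hA.2, Finset.mem_insert_self _ _⟩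
    · intro A hA B hB hAB
      simp only [Finset.coe_filter, Set.mem_ofPred_eq] at hA hB
      rw [← Finset.erase_insert hA.2, ← Finset.erase_insert hB.2]
      exact congrArg (fun S => S.erase j) hAB
  have h2 := Finset.card_filter_add_card_filter_not (s := F) (fun A => j ∈ A)
  rw [memDegree_eq_card] at h
  omega

/-- If `i` has larger degree than `j`, then `i` can be replaced by `j` in some member of `F`. -/
lemma exists_exchange_notMem {n : ℕ} (F : Finset (Finset (Fin n))) (i j : Fin n)
    (h : memDegree F j < memDegree F i) :
    ∃ A ∈ F, i ∈ A ∧ j ∉ A ∧ insert j (A.erase i) ∉ F := by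
  by_contra! hc
  have hij : i ≠ j := by rintro rfl; exact lt_irrefl _ h
  have h1 : (F.filter (fun A => i ∈ A ∧ j ∉ A)).card ≤
      (F.filter (fun A => j ∈ A ∧ i ∉ A)).card := by
    apply Finset.card_le_card_of_injOn (fun A => insert j (A.erase i))
    · intro A hA
      simp only [Finset.coe_filter, Set.mem_ofPred_eq] at hA ⊢
      exact ⟨hc A hA.1 hA.2.1 hA.2.2, by simp, by simp [hij]⟩
    · intro A hA B hB hAB
      simp only [Finset.coe_filter, Set.mem_ofPred_eq] at hA hB
      have key : ∀ S : Finset (Fin n), i ∈ S → j ∉ S →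
          insert i ((insert j (S.erase i)).erase j) = S := by
        intro S hi hj
        rw [Finset.erase_insert (fun hh => hj (Finset.mem_of_mem_erase hh)),
          Finset.insert_erase hi]
      rw [← key A hA.2.1 hA.2.2, ← key B hB.2.1 hB.2.2]
      exact congrArg (fun S => insert i (S.erase j)) hAB
  have h2 := Finset.card_filter_add_card_filter_not (s := F.filter (fun A => i ∈ A))
    (fun A => j ∈ A)
  have h3 := Finset.card_filter_add_card_filter_not (s := F.filter (fun A => j ∈ A))
    (fun A => i ∈ A)
  simp only [Finset.filter_filter] at h2 h3
  have h4 : F.filter (fun A => j ∈ A ∧ i ∈ A) = F.filter (fun A => i ∈ A ∧ j ∈ A) := by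
    simp only [and_comm]
  rw [h4] at h3
  rw [memDegree_eq_card, memDegree_eq_card] at h
  omega

/-- A family of at least `2 * k` subsets of `Fin n` with total size at most `k * n` can be changed
into a family of the same cardinality in which every element has degree `k`. -/
lemma exists_regular_family {n k : ℕ} (F : Finset (Finset (Fin n)))
    (hk : 2 * k ≤ F.card) (hF : ∑ A ∈ F, A.card ≤ k * n) :
    ∃ G : Finset (Finset (Fin n)), G.card = F.card ∧ ∀ i, memDegree G i = k := by
  induction hN : ∑ i, ((memDegree F i - k) + (k - memDegree F i)) using Nat.strong_induction_on
    generalizing F with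
  | _ N ih =>
  subst hN
  have hsum := sum_memDegree F
  by_cases hbig : ∃ i, k < memDegree F i
  · obtain ⟨i, hi⟩ := hbig
    obtain ⟨j, hj⟩ : ∃ j, memDegree F j < k := by
      by_contra! hc
      have : ∑ _i : Fin n, k < ∑ i, memDegree F i :=
        Finset.sum_lt_sum (fun x _ => hc x) ⟨i, Finset.mem_univ _, hi⟩
      simp at this
      rw [mul_comm] at this
      omega
    have hij : i ≠ j := by rintro rfl; omega
    obtain ⟨A, hA, hiA, hjA, hnA⟩ := exists_exchange_notMem F i j (hj.trans hi)
    have hcard : (insert (insert j (A.erase i)) (F.erase A)).card = F.card := by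
      rw [Finset.card_insert_of_notMem (fun hh => hnA (Finset.mem_of_mem_erase hh)),
        Finset.card_erase_add_one hA]
    have hS := sum_insert_erase_add F hA hnA
    have hdeg : ∀ x, memDegree (insert (insert j (A.erase i)) (F.erase A)) x
        + (if x ∈ A then 1 else 0) = memDegree F x + if x ∈ insert j (A.erase i) then 1 else 0 :=
      fun x => hS (fun A => if x ∈ A then 1 else 0)
    have htot : ∑ B ∈ insert (insert j (A.erase i)) (F.erase A), B.card ≤ k * n := by
      have h1 := hS Finset.card
      rw [Finset.card_insert_of_notMem (fun hh => hjA (Finset.mem_of_mem_erase hh)),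
        Finset.card_erase_add_one hiA] at h1
      omega
    have hlt : ∑ x, ((memDegree (insert (insert j (A.erase i)) (F.erase A)) x - k) +
        (k - memDegree (insert (insert j (A.erase i)) (F.erase A)) x))
        < ∑ x, ((memDegree F x - k) + (k - memDegree F x)) := by
      apply Finset.sum_lt_sum
      · intro x _
        have := hdeg x
        by_cases hxi : x = i
        · subst hxi
          simp [hiA, hij] at this
          omega
        · by_cases hxj : x = j
          · subst hxj
            simp [hjA] at this
            omega
          · simp [hxi, hxj] at this
            rw [this]
      · refine ⟨i, Finset.mem_univ _, ?_⟩
        have := hdeg i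
        simp [hiA, hij] at this
        omega
    obtain ⟨G, hG, hG'⟩ := ih _ hlt _ (hcard ▸ hk) htot rfl
    exact ⟨G, hG.trans hcard, hG'⟩
  · push Not at hbig
    by_cases hsmall : ∃ j, memDegree F j < k
    · obtain ⟨j, hj⟩ := hsmall
      obtain ⟨A, hA, hjA, hnA⟩ := exists_insert_notMem F j (by omega)
      have hcard : (insert (insert j A) (F.erase A)).card = F.card := by
        rw [Finset.card_insert_of_notMem (fun hh => hnA (Finset.mem_of_mem_erase hh)),
          Finset.card_erase_add_one hA]
      have hS := sum_insert_erase_add F hA hnA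
      have hdeg : ∀ x, memDegree (insert (insert j A) (F.erase A)) x
          + (if x ∈ A then 1 else 0) = memDegree F x + if x ∈ insert j A then 1 else 0 :=
        fun x => hS (fun A => if x ∈ A then 1 else 0)
      have htot : ∑ B ∈ insert (insert j A) (F.erase A), B.card ≤ k * n := by
        rw [← sum_memDegree]
        calc _ ≤ ∑ _i : Fin n, k := by
              apply Finset.sum_le_sum
              intro x _
              have := hdeg x
              have h2 := hbig x
              by_cases hxj : x = j
              · subst hxj
                simp [hjA] at this
                omega
              · simp [hxj] at this
                omega
          _ = k * n := by simp [mul_comm]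
      have hlt : ∑ x, ((memDegree (insert (insert j A) (F.erase A)) x - k) +
          (k - memDegree (insert (insert j A) (F.erase A)) x))
          < ∑ x, ((memDegree F x - k) + (k - memDegree F x)) := by
        apply Finset.sum_lt_sum
        · intro x _
          have := hdeg x
          by_cases hxj : x = j
          · subst hxj
            simp [hjA] at this
            omega
          · simp [hxj] at this
            rw [this]
        · refine ⟨j, Finset.mem_univ _, ?_⟩
          have := hdeg j
          simp [hjA] at this
          omega
      obtain ⟨G, hG, hG'⟩ := ih _ hlt _ (hcard ▸ hk) htot rfl
      exact ⟨G, hG.trans hcard, hG'⟩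
    · push Not at hsmall
      exact ⟨F, rfl, fun i => le_antisymm (hbig i) (hsmall i)⟩

/-- A family of `m` subsets of `Fin n` with total size at most `k * n` yields a base of size at
most `n` for the action of `Sym(m)` on `k`-subsets. -/
lemma exists_base_of_family {n m k : ℕ} (hkm : 2 * k ≤ m) (F : Finset (Finset (Fin n)))
    (hFm : F.card = m) (hF : ∑ A ∈ F, A.card ≤ k * n) :
    ∃ B : Finset (Finset (Fin m)), B.card ≤ n ∧ (∀ s ∈ B, s.card = k) ∧
      ∀ g : Equiv.Perm (Fin m), (∀ s ∈ B, g • s = s) → g = 1 := by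
  obtain ⟨G, hG, hdeg⟩ := exists_regular_family F (by omega) hF
  let e : Fin m ≃ G := (Finset.equivFinOfCardEq (hG.trans hFm)).symm
  let R : Fin n → Finset (Fin m) := fun i => Finset.univ.filter (fun x => i ∈ (e x : Finset (Fin n)))
  refine ⟨Finset.univ.image R, ?_, ?_, ?_⟩
  · simpa using Finset.card_image_le (s := Finset.univ) (f := R)
  · intro s hs
    obtain ⟨i, -, rfl⟩ := Finset.mem_image.mp hs
    rw [← hdeg i, memDegree_eq_card]
    apply Finset.card_bij (fun x _ => (e x : Finset (Fin n)))
    · intro x hx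
      simpa [R] using hx
    · intro x _ y _ hxy
      exact e.injective (Subtype.ext hxy)
    · intro A hA
      obtain ⟨hA, hi⟩ := Finset.mem_filter.mp hA
      exact ⟨e.symm ⟨A, hA⟩, by simpa [R] using hi, by simp⟩
  · intro g hg
    ext1 x
    apply e.injective
    apply Subtype.ext
    ext i
    have h := hg (R i) (Finset.mem_image_of_mem _ (Finset.mem_univ i))
    have h2 : g • x ∈ g • R i ↔ x ∈ R i := Finset.smul_mem_smul_finset_iff g
    rw [h] at h2
    simpa [R] using h2

/-- `(n / d) ^ d ≤ n.choose d`, cleared of denominators. -/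
lemma pow_le_choose_mul_pow {n d : ℕ} (h : d ≤ n) : n ^ d ≤ n.choose d * d ^ d := by
  have key : ∀ i ≤ d, n ^ i * d.descFactorial i ≤ n.descFactorial i * d ^ i := by
    intro i
    induction i with
    | zero => simp
    | succ i ih =>
      intro hi
      have h1 := ih (by omega)
      rw [Nat.descFactorial_succ, Nat.descFactorial_succ, pow_succ, pow_succ]
      have h2 : n * (d - i) ≤ (n - i) * d := by
        rw [Nat.mul_sub, Nat.sub_mul]
        have := Nat.mul_le_mul_left i h
        rw [mul_comm n i]
        omega
      calc n ^ i * n * ((d - i) * d.descFactorial i)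
          = (n ^ i * d.descFactorial i) * (n * (d - i)) := by ring
        _ ≤ (n.descFactorial i * d ^ i) * ((n - i) * d) := Nat.mul_le_mul h1 h2
        _ = _ := by ring
  have h1 := key d le_rfl
  rw [Nat.descFactorial_self, Nat.descFactorial_eq_factorial_mul_choose] at h1
  apply Nat.le_of_mul_le_mul_right _ (Nat.factorial_pos d)
  linarith

lemma exists_family_of_pow_le {n m k d : ℕ} (hd : 0 < d) (hdn : d ≤ n) (h : m * d ^ d ≤ n ^ d)
    (hk : d * m ≤ k * n) :
    ∃ F : Finset (Finset (Fin n)), F.card = m ∧ ∑ A ∈ F, A.card ≤ k * n := by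
  have hm : m ≤ (Finset.powersetCard d (Finset.univ : Finset (Fin n))).card := by
    simp only [Finset.card_powersetCard, Finset.card_univ, Fintype.card_fin]
    exact Nat.le_of_mul_le_mul_right (h.trans (pow_le_choose_mul_pow hdn)) (pow_pos hd d)
  obtain ⟨F, hF, hFm⟩ := Finset.exists_subset_card_eq hm
  refine ⟨F, hFm, ?_⟩
  rw [Finset.sum_congr rfl (fun A hA => (Finset.mem_powersetCard.mp (hF hA)).2)]
  simpa [hFm, mul_comm] using hk

/-- A family consisting of subsets of size at most two, including all those of size at most one if
there are enough members. -/
lemma exists_family_of_card_le_two {n m k : ℕ} (hk : 1 ≤ k) (hm : m ≤ 1 + n + n.choose 2)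
    (h : 2 * m ≤ n * (k + 1) + 2) :
    ∃ F : Finset (Finset (Fin n)), F.card = m ∧ ∑ A ∈ F, A.card ≤ k * n := by
  let P : ℕ → Finset (Finset (Fin n)) := fun d => Finset.powersetCard d Finset.univ
  have hP : ∀ d, (P d).card = n.choose d := by simp [P]
  have hPm : ∀ d A, A ∈ P d ↔ A.card = d := by simp [P]
  have hdis : ∀ a b, a ≠ b → Disjoint (P a) (P b) := fun a b hab =>
    Finset.pairwise_disjoint_powersetCard _ hab
  have hS : ∑ A ∈ P 0 ∪ P 1, A.card = n := by
    rw [Finset.sum_union (hdis 0 1 (by simp)),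
      Finset.sum_congr rfl (fun A hA => (hPm 0 A).1 hA),
      Finset.sum_congr rfl (fun A hA => (hPm 1 A).1 hA)]
    simp [hP]
  have hC : (P 0 ∪ P 1).card = n + 1 := by
    rw [Finset.card_union_of_disjoint (hdis 0 1 (by simp)), hP, hP]
    simp [add_comm]
  rcases le_or_gt m (n + 1) with hmn | hmn
  · obtain ⟨F, hF, hFm⟩ := Finset.exists_subset_card_eq (hmn.trans_eq hC.symm)
    refine ⟨F, hFm, (Finset.sum_le_sum_of_subset hF).trans ?_⟩
    rw [hS]
    exact Nat.le_mul_of_pos_left n hk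
  · have hd2 : Disjoint (P 0 ∪ P 1) (P 2) :=
      Finset.disjoint_union_left.2 ⟨hdis 0 2 (by simp), hdis 1 2 (by simp)⟩
    have hm2 : m - (n + 1) ≤ (P 2).card := by rw [hP]; omega
    obtain ⟨F, hF, hFm⟩ := Finset.exists_subset_card_eq hm2
    have hdF := Finset.disjoint_of_subset_right hF hd2
    refine ⟨(P 0 ∪ P 1) ∪ F, ?_, ?_⟩
    · rw [Finset.card_union_of_disjoint hdF, hC, hFm]
      omega
    · rw [Finset.sum_union hdF, hS, Finset.sum_congr rfl (fun A hA => (hPm 2 A).1 (hF hA))]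
      simp only [Finset.sum_const, hFm, smul_eq_mul]
      have : n * (k + 1) = k * n + n := by ring
      omega

lemma one_add_sub_exp_div_le_log {x : ℝ} (hx : 0 < x) (a : ℝ) :
    1 + a - Real.exp a / x ≤ Real.log x := by
  have h := Real.one_sub_inv_le_log_of_pos (div_pos hx (Real.exp_pos a))
  rw [Real.log_div hx.ne' (Real.exp_pos a).ne', Real.log_exp, inv_div] at h
  linarith

lemma mul_log_sub_one_le_log_factorial {n : ℕ} (hn : 0 < n) :
    n * (Real.log n - 1) ≤ Real.log n.factorial := by
  have hn' : (0 : ℝ) < n := by exact_mod_cast hn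
  have hf : (0 : ℝ) < n.factorial := by exact_mod_cast n.factorial_pos
  have h := Real.log_le_log (by positivity) (Real.pow_div_factorial_le_exp (n : ℝ) hn'.le n)
  rw [Real.log_exp, Real.log_div (by positivity) hf.ne', Real.log_pow] at h
  linarith

lemma log_choose_le {m k : ℕ} (hk : 0 < k) (hkm : k ≤ m) :
    Real.log (m.choose k) ≤ k * (Real.log m - Real.log k + 1) := by
  have hm' : (0 : ℝ) < m := by exact_mod_cast hk.trans_le hkm
  have hf : (0 : ℝ) < k.factorial := by exact_mod_cast k.factorial_pos
  have hc : (0 : ℝ) < m.choose k := by exact_mod_cast Nat.choose_pos hkm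
  have h := Real.log_le_log hc (Nat.choose_le_pow_div (α := ℝ) k m)
  rw [Real.log_div (by positivity) hf.ne', Real.log_pow] at h
  have := mul_log_sub_one_le_log_factorial hk
  linarith

lemma exp_five_halves_lt : Real.exp (5 / 2) < 12.2 := by
  have h : Real.exp (5 / 2) ^ 2 = Real.exp 1 ^ 5 := by
    rw [← Real.exp_nat_mul, ← Real.exp_nat_mul]; norm_num
  have h1 : Real.exp 1 ^ 5 < 2.7182818286 ^ 5 :=
    pow_lt_pow_left₀ Real.exp_one_lt_d9 (Real.exp_pos 1).le (by norm_num)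
  apply lt_of_pow_lt_pow_left₀ 2 (by norm_num)
  rw [h]
  exact h1.trans (by norm_num)

lemma exp_natCast_lt (a : ℕ) (ha : a ≠ 0) : Real.exp a < 2.7182818286 ^ a := by
  rw [← Real.exp_one_pow]
  exact pow_lt_pow_left₀ Real.exp_one_lt_d9 (Real.exp_pos 1).le ha

lemma five_mul_sub_le_log_mul {r : ℝ} (hr : 4 ≤ r) : 5 * r - 15 ≤ Real.log r * (r + 15) := by
  have h0 : 0 < r := by linarith
  rcases le_total r 25 with h | h
  · have h1 := one_add_sub_exp_div_le_log h0 (5 / 2)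
    have h2 : Real.exp (5 / 2) / r ≤ 12.2 / r := by gcongr; exact exp_five_halves_lt.le
    have h3 : 1 + 5 / 2 - 12.2 / r ≤ Real.log r := by linarith
    refine le_trans ?_ (mul_le_mul_of_nonneg_right h3 (by linarith))
    have h4 : (1 + 5 / 2 - 12.2 / r) * (r + 15) - (5 * r - 15)
        = (-1.5 * r ^ 2 + 55.3 * r - 183) / r := by field_simp; ring
    have : 0 ≤ (-1.5 * r ^ 2 + 55.3 * r - 183) / r := by
      apply div_nonneg _ h0.le
      nlinarith
    linarith
  · have h1 := one_add_sub_exp_div_le_log h0 4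
    have he : Real.exp 4 ≤ 55 := by
      have := exp_natCast_lt 4 (by norm_num)
      norm_num at this
      linarith
    have h2 : Real.exp 4 / r ≤ 55 / r := by gcongr
    have h3 : 1 + 4 - 55 / r ≤ Real.log r := by linarith
    refine le_trans ?_ (mul_le_mul_of_nonneg_right h3 (by linarith))
    have h4 : (1 + 4 - 55 / r) * (r + 15) - (5 * r - 15) = (35 * r - 825) / r := by
      field_simp; ring
    have : 0 ≤ (35 * r - 825) / r := div_nonneg (by linarith) h0.le
    linarith

lemma log_four : Real.log 4 = 2 * Real.log 2 := by
  rw [show (4 : ℝ) = 2 ^ 2 by norm_num, Real.log_pow]; norm_num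

lemma exists_family_of_le_four_mul {n m k : ℕ} (hm : 5 ≤ m) (hkm : k ≤ m) (h4 : m ≤ 4 * k)
    (hn : 2 * (Real.log m.factorial / Real.log (m.choose k)) + 15 ≤ n)
    (hC : 0 < Real.log (m.choose k)) :
    ∃ F : Finset (Finset (Fin n)), F.card = m ∧ ∑ A ∈ F, A.card ≤ k * n := by
  have hm' : (0 : ℝ) < m := by positivity
  have hc : (0 : ℝ) < m.choose k := by exact_mod_cast Nat.choose_pos hkm
  have hl2 := Real.log_two_gt_d9
  have hCle : Real.log (m.choose k) ≤ m * Real.log 2 := by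
    rw [← Real.log_pow]
    exact Real.log_le_log hc (by exact_mod_cast Nat.choose_le_two_pow m k)
  have hf := mul_log_sub_one_le_log_factorial (n := m) (by omega)
  have hQ0 : 0 ≤ Real.log m.factorial / Real.log (m.choose k) :=
    div_nonneg (Real.log_natCast_nonneg _) hC.le
  have hQ : Real.log m - 1 ≤ Real.log m.factorial / Real.log (m.choose k) * Real.log 2 := by
    have h1 : Real.log m.factorial / Real.log (m.choose k) * Real.log (m.choose k)
        = Real.log m.factorial := div_mul_cancel₀ _ hC.ne'
    have h2 := mul_le_mul_of_nonneg_left hCle hQ0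
    refine le_of_mul_le_mul_left ?_ hm'
    linarith
  have hn15 : 15 ≤ n := by
    have : (15 : ℝ) ≤ n := by linarith
    exact_mod_cast this
  have hd : n ≤ 4 * (n / 4) + 3 := by omega
  have hd' : (n : ℝ) ≤ 4 * (n / 4 : ℕ) + 3 := by exact_mod_cast hd
  have hlog : Real.log m ≤ (n / 4 : ℕ) * Real.log 4 := by
    rw [log_four]
    nlinarith
  have hpow : m ≤ 4 ^ (n / 4) := by
    have h1 : Real.log m ≤ Real.log ((4 : ℝ) ^ (n / 4)) := by rwa [Real.log_pow]
    have h2 := (Real.log_le_log_iff hm' (by positivity)).1 h1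
    exact_mod_cast h2
  refine exists_family_of_pow_le (d := n / 4) (by omega) (by omega) ?_ ?_
  · calc m * (n / 4) ^ (n / 4) ≤ 4 ^ (n / 4) * (n / 4) ^ (n / 4) := Nat.mul_le_mul_right _ hpow
      _ = (4 * (n / 4)) ^ (n / 4) := (mul_pow _ _ _).symm
      _ ≤ n ^ (n / 4) := Nat.pow_le_pow_left (by omega) _
  · calc n / 4 * m ≤ n / 4 * (4 * k) := Nat.mul_le_mul_left _ h4
      _ = k * (4 * (n / 4)) := by ring
      _ ≤ k * n := Nat.mul_le_mul_left _ (by omega)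

lemma exists_family_of_four_mul_le_of_two_mul_le {n m k : ℕ} (hk : 1 ≤ k) (h4 : 4 * k ≤ m)
    (hn : 2 * m * (Real.log m - 1) + 15 * (k * (Real.log m - Real.log k + 1))
      ≤ n * (k * (Real.log m - Real.log k + 1)))
    (hD : 2 * m ≤ k * n) :
    ∃ F : Finset (Finset (Fin n)), F.card = m ∧ ∑ A ∈ F, A.card ≤ k * n := by
  have hk' : (0 : ℝ) < k := by exact_mod_cast hk
  have hm0 : 0 < m := by omega
  have hm' : (0 : ℝ) < m := by exact_mod_cast hm0
  have hl2 := Real.log_two_gt_d9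
  have hr : (4 : ℝ) ≤ m / k := by
    rw [le_div_iff₀ hk']; exact_mod_cast h4
  have hlog : Real.log (m / k : ℝ) = Real.log m - Real.log k :=
    Real.log_div hm'.ne' hk'.ne'
  have hl : 1.38 ≤ Real.log (m / k : ℝ) := by
    have := Real.log_le_log (by norm_num) hr
    rw [log_four] at this
    linarith
  have htan := five_mul_sub_le_log_mul hr
  set d := k * n / m with hd
  have hd2 : 2 ≤ d := (Nat.le_div_iff_mul_le hm0).2 hD
  have hdm : d * m ≤ k * n := Nat.div_mul_le_self _ _
  have hdm' : k * n < (d + 1) * m := by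
    have := Nat.lt_div_mul_add (a := k * n) hm0
    rw [← hd] at this
    linarith
  have hdn : d ≤ n := by
    have h1 : d * m ≤ n * m := hdm.trans (by rw [mul_comm]; exact Nat.mul_le_mul_left _ (by omega))
    exact Nat.le_of_mul_le_mul_right h1 hm0
  have hmain : Real.log m ≤ d * Real.log (m / k : ℝ) := by
    rw [← hlog] at hn
    set l := Real.log (m / k : ℝ)
    have hd2' : (2 : ℝ) ≤ d := by exact_mod_cast hd2
    have h1 : (k * n : ℝ) ≤ (d + 1) * m := by exact_mod_cast hdm'.le
    have h2 : (m : ℝ) * (5 - l) ≤ k * 15 * (l + 1) := by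
      have e : (m : ℝ) = k * (m / k) := by field_simp
      rw [e]
      nlinarith
    have h3 : 2 * m * (Real.log m - 1) + m * (5 - l) ≤ (d + 1) * m * (l + 1) := by nlinarith
    have h4 : 2 * (Real.log m - 1) + (5 - l) ≤ (d + 1) * (l + 1) := by
      refine le_of_mul_le_mul_left ?_ hm'
      linarith
    nlinarith
  have hpow : (m : ℝ) ≤ (m / k : ℝ) ^ d := by
    rw [← Real.log_pow] at hmain
    exact (Real.log_le_log_iff hm' (by positivity)).1 hmain
  refine exists_family_of_pow_le (d := d) (by omega) hdn ?_ hdm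
  have h5 : (m / k : ℝ) * d ≤ n := by
    rw [div_mul_eq_mul_div, div_le_iff₀ hk']
    have : (d * m : ℝ) ≤ k * n := by exact_mod_cast hdm
    linarith
  have : (m * d ^ d : ℝ) ≤ n ^ d := by
    calc (m * d ^ d : ℝ) ≤ (m / k : ℝ) ^ d * d ^ d := by gcongr
      _ = (m / k * d : ℝ) ^ d := (mul_pow _ _ _).symm
      _ ≤ n ^ d := by gcongr
  exact_mod_cast this

lemma exists_family_of_four_mul_le_of_lt_two_mul {n m k : ℕ} (hk : 1 ≤ k) (h4 : 4 * k ≤ m)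
    (hn15 : 15 ≤ n)
    (hn : 2 * m * (Real.log m - 1) + 15 * (k * (Real.log m - Real.log k + 1))
      ≤ n * (k * (Real.log m - Real.log k + 1)))
    (hD : k * n < 2 * m) :
    ∃ F : Finset (Finset (Fin n)), F.card = m ∧ ∑ A ∈ F, A.card ≤ k * n := by
  have hk1 : (1 : ℝ) ≤ k := by exact_mod_cast hk
  have hk' : (0 : ℝ) < k := by linarith
  have hm0 : 0 < m := by omega
  have hm' : (0 : ℝ) < m := by exact_mod_cast hm0
  have hl2 := Real.log_two_gt_d9
  have hl : 1 ≤ Real.log m - Real.log k := by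
    have hr : (4 : ℝ) ≤ m / k := by
      rw [le_div_iff₀ hk']; exact_mod_cast h4
    have := Real.log_le_log (by norm_num) hr
    rw [log_four, Real.log_div hm'.ne' hk'.ne'] at this
    linarith
  have hk8 : k < 8 := by
    by_contra! h8
    have h8' : (8 : ℝ) ≤ k := by exact_mod_cast h8
    have h1 := Real.log_le_log (by norm_num) h8'
    rw [show (8 : ℝ) = 2 ^ 3 by norm_num, Real.log_pow] at h1
    have hD' : (k * n : ℝ) < 2 * m := by exact_mod_cast hD
    push_cast at h1
    nlinarith
  have hmk : 2 * m ≤ n * (k + 1) + 2 := by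
    by_contra! hc
    have hc' : (n * (k + 1) + 2 : ℝ) < 2 * m := by exact_mod_cast hc
    have hA := one_add_sub_exp_div_le_log hm' 3
    have hB := one_add_sub_exp_div_le_log hk' 1
    have e1 : m * (Real.exp 3 / m) = Real.exp 3 := by field_simp
    have e2 : k * (Real.exp 1 / k) = Real.exp 1 := by field_simp
    have he3 : Real.exp 3 ≤ 21 := by
      have := exp_natCast_lt 3 (by norm_num)
      norm_num at this
      linarith
    have he1 := Real.exp_one_lt_d9
    have hA' : 4 * m - 21 ≤ m * Real.log m := by nlinarith
    have hB' : 2 * k - 3 ≤ k * Real.log k := by nlinarith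
    set l := Real.log m - Real.log k with hl_def
    have h1 : (k + 1) * (2 * m * (Real.log m - 1) + 15 * (k * (l + 1)))
        ≤ (k + 1) * (n * (k * (l + 1))) := mul_le_mul_of_nonneg_left hn (by linarith)
    have h2 : (k * (l + 1)) * (n * (k + 1) + 2) ≤ (k * (l + 1)) * (2 * m) :=
      mul_le_mul_of_nonneg_left hc'.le (by nlinarith)
    have h3 : 2 * m * (Real.log m - (2 * k + 1 - k * Real.log k))
        + (15 * k ^ 2 + 17 * k) * (l + 1) ≤ 0 := by
      have : Real.log m = l + Real.log k := by rw [hl_def]; ring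
      rw [this] at h1 ⊢
      nlinarith
    have h4 : (m : ℝ) * (2 * k + 1 - k * Real.log k) ≤ m * 4 :=
      mul_le_mul_of_nonneg_left (by linarith) hm'.le
    have h5 : (32 : ℝ) * 2 ≤ (15 * k ^ 2 + 17 * k) * (l + 1) :=
      mul_le_mul (by nlinarith) (by linarith) (by norm_num) (by positivity)
    nlinarith
  refine exists_family_of_card_le_two hk ?_ hmk
  have h1 : n.choose 2 * 2 = n * (n - 1) := by
    rw [Nat.choose_two_right]
    exact Nat.div_mul_cancel (Nat.even_mul_pred_self n).two_dvd
  have h2 : n * (k + 1) ≤ n * (n + 1) := Nat.mul_le_mul_left _ (by omega)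
  obtain ⟨p, rfl⟩ : ∃ p, n = p + 1 := ⟨n - 1, by omega⟩
  simp only [Nat.add_sub_cancel] at h1
  nlinarith

/-- For integers `m ≥ 5`, `1 ≤ k`, `2k ≤ m`, the minimal base size
`b(m,k)` of `Sym(m)` acting on `k`-element subsets of `{1,…,m}` satisfies
`b(m,k) ≤ 2 ln(m!)/ln C(m,k) + 16`. -/
theorem base_size_subsets_le (m k : ℕ) (hm : 5 ≤ m) (hk : 1 ≤ k) (hkm : 2 * k ≤ m) :
    ((sInf {c : ℕ | ∃ B : Finset (Finset (Fin m)), B.card = c ∧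
        (∀ s ∈ B, s.card = k) ∧
        ∀ g : Equiv.Perm (Fin m), (∀ s ∈ B, g • s = s) → g = 1} : ℕ) : ℝ) ≤
      2 * (Real.log (m.factorial) / Real.log (m.choose k)) + 16 := by
  have hkm' : k ≤ m := by omega
  have hC : 0 < Real.log (m.choose k) := by
    apply Real.log_pos
    have : 1 < m.choose k := by
      by_contra! h1
      have h2 := (pow_le_choose_mul_pow hkm').trans (Nat.mul_le_mul_right _ h1)
      have h3 : k ^ k < m ^ k := Nat.pow_lt_pow_left (by omega) (by omega)
      omega
    exact_mod_cast this
  set Q := Real.log m.factorial / Real.log (m.choose k) with hQ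
  have hQ0 : 0 ≤ Q := div_nonneg (Real.log_natCast_nonneg _) hC.le
  set n := ⌊2 * Q + 16⌋₊ with hn_def
  have hn : 2 * Q + 15 ≤ n := by
    have := Nat.lt_floor_add_one (2 * Q + 16)
    linarith
  have hn15 : 15 ≤ n := by
    have : (15 : ℝ) ≤ n := by linarith
    exact_mod_cast this
  have hfam : ∃ F : Finset (Finset (Fin n)), F.card = m ∧ ∑ A ∈ F, A.card ≤ k * n := by
    rcases le_total m (4 * k) with h4 | h4
    · exact exists_family_of_le_four_mul hm hkm' h4 hn hC
    · have hL : 2 * m * (Real.log m - 1) + 15 * (k * (Real.log m - Real.log k + 1))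
          ≤ n * (k * (Real.log m - Real.log k + 1)) := by
        have h1 := log_choose_le hk hkm'
        have h2 := mul_log_sub_one_le_log_factorial (n := m) (by omega)
        have h3 : Q * Real.log (m.choose k) = Real.log m.factorial := div_mul_cancel₀ _ hC.ne'
        have h4 := mul_le_mul_of_nonneg_left h1 hQ0
        have h5 := mul_le_mul_of_nonneg_right hn (hC.le.trans h1)
        linarith
      rcases lt_or_ge (k * n) (2 * m) with hD | hD
      · exact exists_family_of_four_mul_le_of_lt_two_mul hk h4 hn15 hL hD
      · exact exists_family_of_four_mul_le_of_two_mul_le hk h4 hL hD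
  obtain ⟨F, hFm, hF⟩ := hfam
  obtain ⟨B, hBn, hBk, hB⟩ := exists_base_of_family hkm F hFm hF
  refine le_trans (Nat.cast_le.2 (Nat.sInf_le ⟨B, rfl, hBk, hB⟩)) ?_
  calc (B.card : ℝ) ≤ n := by exact_mod_cast hBn
    _ ≤ 2 * Q + 16 := Nat.floor_le (by linarith)
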